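/- arXiv:2511.08860 — 14 statements merged into one kernel-verified Lean document; each statement's English description precedes it below -/
import Mathlib

section
/- Let F : ℝ^d → ℝ^d be real analytic, let U ⊆ ℝ be open, and let u : U → ℝ^d be differentiable with u'(t) = F(u(t)) for all t ∈ U. Let D = u(U). Suppose A ⊆ ℝ^d is a set of uniqueness for real analytic functions ℝ^d → ℝ^d and D is dense in A (i.e., A is contained in the closure of D). Then F is the unique real analytic function G : ℝ^d → ℝ^d satisfying u'(t) = G(u(t)) for all t ∈ U. -/
/-- Let `F : ℝ^d → ℝ^d` be real analytic, `u` a trajectory of `F` on an open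
set `U ⊆ ℝ`, and `D = u '' U`.  If `A` is a set of uniqueness for real analytic functions
`ℝ^d → ℝ^d` and `D` is dense in `A` (i.e. `A ⊆ closure D`), then `F` is the unique real
analytic function `G` with `u' t = G (u t)` for all `t ∈ U`. -/
theorem analytic_unique_of_image_dense_in_set_of_uniqueness
    (d : ℕ) (F : (Fin d → ℝ) → (Fin d → ℝ)) (hF : ∀ x, AnalyticAt ℝ F x)
    (U : Set ℝ) (hU : IsOpen U) (u : ℝ → (Fin d → ℝ))
    (hode : ∀ t ∈ U, HasDerivAt u (F (u t)) t)
    (A : Set (Fin d → ℝ))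
    (hA : ∀ G : (Fin d → ℝ) → (Fin d → ℝ),
      (∀ x, AnalyticAt ℝ G x) → (∀ x ∈ A, G x = 0) → G = 0)
    (hdense : A ⊆ closure (u '' U)) :
    ∀ G : (Fin d → ℝ) → (Fin d → ℝ), (∀ x, AnalyticAt ℝ G x) →
      (∀ t ∈ U, HasDerivAt u (G (u t)) t) → G = F := by
  intro G hG hGode
  refine sub_eq_zero.mp (hA (G - F) (fun x => (hG x).sub (hF x)) fun x hx => ?_)
  have hcont : Continuous (G - F) :=
    continuous_iff_continuousAt.mpr fun y => ((hG y).sub (hF y)).continuousAt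
  have hclosed : IsClosed {y | (G - F) y = 0} := isClosed_eq hcont continuous_const
  refine closure_minimal ?_ hclosed (hdense hx)
  rintro _ ⟨t, ht, rfl⟩
  exact sub_eq_zero.mpr ((hGode t ht).unique (hode t ht))
end

section
/- Let A ⊆ ℝ^d be a set whose Hausdorff dimension is strictly greater than d − 1. Then A is a set of uniqueness for real analytic functions: every real analytic function F : ℝ^d → ℝ^d (equivalently, every real analytic f : ℝ^d → ℝ) vanishing on A is identically zero. -/
open scoped ENNReal

open Set Filter Topology

section

variable {E G : Type*} [NormedAddCommGroup E] [NormedSpace ℝ E]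
  [NormedAddCommGroup G] [NormedSpace ℝ G]

/-- Near a point where a strictly differentiable map has nonzero derivative, its fibres have
positive codimension. -/
theorem HasStrictFDerivAt.exists_mem_nhds_dimH_le [FiniteDimensional ℝ E] {h : E → G}
    {h' : E →L[ℝ] G} {x : E} (hh : HasStrictFDerivAt h h' x) (hne : h' ≠ 0) (c : G) :
    ∃ U ∈ 𝓝 x, dimH (U ∩ h ⁻¹' {c}) ≤ ((Module.finrank ℝ E - 1 : ℕ) : ℝ≥0∞) := by
  obtain ⟨v, hv⟩ : ∃ v, h' v ≠ 0 := by
    by_contra! H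
    exact hne (ContinuousLinearMap.ext H)
  obtain ⟨φ, hφ⟩ := SeparatingDual.exists_eq_one (R := ℝ) hv
  set l : E →L[ℝ] ℝ := φ.comp h' with hl
  have hlv : l v = 1 := hφ
  have hg : HasStrictFDerivAt (fun y ↦ φ (h y)) l x := φ.hasStrictFDerivAt.comp x hh
  set ε : ℝ := (2 * (‖v‖ + 1))⁻¹ with hε
  have hε0 : 0 < ε := by positivity
  have hεv : ε * ‖v‖ ≤ 1 / 2 := by
    rw [hε, inv_mul_le_iff₀ (by positivity)]
    linarith
  obtain ⟨U, hU, hUg⟩ := hg.approximates_deriv_on_nhds (c := ⟨ε, hε0.le⟩) (Or.inr hε0)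
  refine ⟨U, hU, ?_⟩
  let p : E → E := fun y ↦ y - l y • v
  have hp : AntilipschitzWith 2 (fun y : ↥(U ∩ h ⁻¹' {c}) ↦ p y) := by
    refine AntilipschitzWith.of_le_mul_dist ?_
    rintro ⟨y, hyU, hy⟩ ⟨z, hzU, hz⟩
    have h1 := hUg y hyU z hzU
    simp only [mem_preimage, mem_singleton_iff] at hy hz
    simp only [hy, hz, sub_self, zero_sub, norm_neg] at h1
    have h2 : p y - p z = (y - z) - l (y - z) • v := by
      simp only [p, map_sub, sub_smul]
      abel
    have h3 : ‖l (y - z) • v‖ ≤ 1 / 2 * ‖y - z‖ := by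
      rw [norm_smul]
      calc _ ≤ ε * ‖y - z‖ * ‖v‖ := by gcongr; exact h1
        _ = ε * ‖v‖ * ‖y - z‖ := by ring
        _ ≤ _ := by gcongr
    have h4 := norm_sub_norm_le (y - z) (l (y - z) • v)
    rw [Subtype.dist_eq, dist_eq_norm, dist_eq_norm, h2]
    push_cast
    linarith
  have hker : Module.finrank ℝ l.ker = Module.finrank ℝ E - 1 := by
    have hr := l.toLinearMap.finrank_range_add_finrank_ker
    have hs : Function.Surjective l.toLinearMap := fun t ↦ ⟨t • v, by simp [hlv]⟩
    rw [LinearMap.range_eq_top.2 hs, finrank_top, Module.finrank_self] at hr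
    have : Module.finrank ℝ l.ker = Module.finrank ℝ l.toLinearMap.ker := rfl
    omega
  calc dimH (U ∩ h ⁻¹' {c})
      = dimH (univ : Set ↥(U ∩ h ⁻¹' {c})) := by
        have hi : Isometry ((↑) : ↥(U ∩ h ⁻¹' {c}) → E) := isometry_subtype_coe
        rw [← hi.dimH_image, image_univ, Subtype.range_coe]
    _ ≤ dimH ((fun y : ↥(U ∩ h ⁻¹' {c}) ↦ p y) '' univ) := hp.le_dimH_image _
    _ ≤ dimH (range l.ker.subtypeL) := by
        refine dimH_mono ?_
        rintro _ ⟨y, -, rfl⟩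
        exact ⟨⟨p y, by simp [p, hlv]⟩, rfl⟩
    _ ≤ Module.finrank ℝ l.ker := l.ker.subtypeL.contDiff.dimH_range_le
    _ = _ := by rw [hker]

/-- An analytic function on a normed space, all of whose derivatives vanish at one point, is
zero. -/
theorem eq_zero_of_forall_iteratedFDeriv_eq_zero [CompleteSpace G] {f : E → G}
    (hf : ∀ y, AnalyticAt ℝ f y) {x : E} (h : ∀ n, iteratedFDeriv ℝ n f x = 0) : f = 0 := by
  obtain ⟨p, r, hp⟩ := hf x
  refine AnalyticOnNhd.eq_of_eventuallyEq (z₀ := x) (fun y _ ↦ hf y)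
    (fun y _ ↦ analyticAt_const) ?_
  filter_upwards [Metric.eball_mem_nhds x hp.r_pos] with y hy
  have hs := hp.hasSum_iteratedFDeriv (y := y - x)
    (by simpa [edist_eq_enorm_sub] using hy)
  simpa [h] using hs.unique (by simp [h])

/-- An analytic function on a finite-dimensional space that vanishes on a set of Hausdorff
dimension greater than the dimension of the space minus one is zero. -/
theorem eq_zero_of_eqOn_zero_of_lt_dimH [FiniteDimensional ℝ E] [CompleteSpace G] {f : E → G}
    (hf : ∀ y, AnalyticAt ℝ f y) {A : Set E}
    (hA : ((Module.finrank ℝ E - 1 : ℕ) : ℝ≥0∞) < dimH A) (hfA : ∀ x ∈ A, f x = 0) : f = 0 := by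
  by_contra hne
  let S : ℕ → Set E := fun n ↦
    {x | iteratedFDeriv ℝ n f x = 0 ∧ iteratedFDeriv ℝ (n + 1) f x ≠ 0}
  have hAS : A ⊆ ⋃ n, S n := by
    intro x hx
    by_contra! hxS
    refine hne (eq_zero_of_forall_iteratedFDeriv_eq_zero hf (x := x) fun n ↦ ?_)
    induction n with
    | zero => ext; simp [hfA x hx]
    | succ n ih =>
      by_contra h
      exact hxS (mem_iUnion.2 ⟨n, ih, h⟩)
  have hlt := hA.trans_le (dimH_mono hAS)
  rw [dimH_iUnion, lt_iSup_iff] at hlt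
  obtain ⟨n, hn⟩ := hlt
  obtain ⟨x, hx, hxS⟩ := exists_mem_nhdsWithin_lt_dimH_of_lt_dimH hn
  have hd : HasStrictFDerivAt (iteratedFDeriv ℝ n f) (fderiv ℝ (iteratedFDeriv ℝ n f) x) x :=
    (AnalyticOnNhd.iteratedFDeriv (s := univ) (fun y _ ↦ hf y) n x
      (mem_univ x)).hasStrictFDerivAt
  have hd0 : fderiv ℝ (iteratedFDeriv ℝ n f) x ≠ 0 := by
    intro h0
    refine hx.2 ?_
    rw [iteratedFDeriv_succ_eq_comp_left, Function.comp_apply, h0]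
    exact LinearIsometryEquiv.map_zero _
  obtain ⟨U, hU, hUd⟩ := hd.exists_mem_nhds_dimH_le hd0 0
  have hUS : U ∩ S n ∈ 𝓝[S n] x := inter_mem (mem_nhdsWithin_of_mem_nhds hU) self_mem_nhdsWithin
  exact (hxS _ hUS).not_ge
    ((dimH_mono (inter_subset_inter_right _ fun y hy ↦ hy.1)).trans hUd)

end

/-- Dimension Criterion: Any set `A ⊆ ℝ^d` with Hausdorff dimension strictly
greater than `d - 1` is a set of uniqueness for real analytic functions: every real
analytic `F : ℝ^d → ℝ^d` vanishing on `A` is identically zero. -/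
theorem analytic_eq_zero_of_vanishing_on_set_of_large_dimH
    (d : ℕ) (A : Set (EuclideanSpace ℝ (Fin d)))
    (hA : (d : ℝ≥0∞) - 1 < dimH A)
    (F : EuclideanSpace ℝ (Fin d) → EuclideanSpace ℝ (Fin d))
    (hF : ∀ x, AnalyticAt ℝ F x)
    (hvan : ∀ x ∈ A, F x = 0) :
    F = 0 := by
  exact eq_zero_of_eqOn_zero_of_lt_dimH hF (by simpa using hA) hvan
end

section
/- Let F¹, F² : ℝ^d → ℝ^d be real analytic and let H : ℝ^d × ℝ^d → ℝ be real analytic, where H(v, u) has v as its first argument and u as the second. Assume that the gradient of H in its first argument satisfies ∇_v H(Fⁱ(u), u) = 0 for i = 1, 2 and for all u ∈ ℝ^d. Suppose F¹ and F² agree on a nonempty set A ⊆ ℝ^d, and that there exists p ∈ A such that the Hessian of H in its first argument, ∇²_v H(F¹(p), p), is a nonsingular d × d matrix. Then F¹ = F² on all of ℝ^d. -/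
open Filter Topology

/-- The partial gradient of a jointly analytic function is jointly analytic. -/
theorem analyticAt_gradient_fst {E P : Type*} [NormedAddCommGroup E] [InnerProductSpace ℝ E]
    [CompleteSpace E] [NormedAddCommGroup P] [NormedSpace ℝ P] {H : E → P → ℝ}
    (hH : ∀ q : E × P, AnalyticAt ℝ (fun q : E × P => H q.1 q.2) q) (q : P × E) :
    AnalyticAt ℝ (fun q : P × E => gradient (fun v => H v q.1) q.2) q := by
  obtain ⟨L, hL⟩ : ∃ L : StrongDual ℝ E →L[ℝ] E,
      ∀ φ, L φ = (InnerProductSpace.toDual ℝ E).symm φ :=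
    ⟨{ toFun := (InnerProductSpace.toDual ℝ E).symm
       map_add' := map_add _
       map_smul' := fun c φ => by simp
       cont := (InnerProductSpace.toDual ℝ E).symm.continuous }, fun _ => rfl⟩
  have hpartial : (fun q : P × E => gradient (fun v => H v q.1) q.2) = fun q =>
      L ((ContinuousLinearMap.compL ℝ E (E × P) ℝ).flip (.inl ℝ E P)
          (fderiv ℝ (fun q : E × P => H q.1 q.2) (q.2, q.1))) := by
    ext1 q
    have hslice : HasFDerivAt (fun v => H v q.1)
        ((fderiv ℝ (fun q : E × P => H q.1 q.2) (q.2, q.1)).comp (.inl ℝ E P)) q.2 :=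
      HasFDerivAt.comp (g := fun q : E × P => H q.1 q.2) (f := fun v => (v, q.1)) q.2
        (hH (q.2, q.1)).differentiableAt.hasFDerivAt (hasFDerivAt_prodMk_left q.2 q.1)
    simp [gradient, hL, hslice.fderiv]
  rw [hpartial]
  have hswap : AnalyticAt ℝ (fun q : P × E => (q.2, q.1)) q := analyticAt_snd.prod analyticAt_fst
  have hfderiv : AnalyticAt ℝ
      (fun q : P × E => fderiv ℝ (fun q : E × P => H q.1 q.2) (q.2, q.1)) q :=
    AnalyticAt.fun_comp (f := fun q : P × E => (q.2, q.1)) (hH (q.2, q.1)).fderiv hswap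
  exact (L.analyticAt _).fun_comp ((ContinuousLinearMap.analyticAt _ _).fun_comp hfderiv)

/-- Two continuous solutions of `f (u, g u) = c` that agree at `p` agree near `p`, provided that the
partial derivative of `f` in its second argument is invertible at `(p, g p)`. -/
theorem eventuallyEq_of_apply_eq_of_isInvertible {E P G : Type*}
    [NormedAddCommGroup E] [NormedSpace ℝ E] [CompleteSpace E]
    [NormedAddCommGroup P] [NormedSpace ℝ P] [CompleteSpace P]
    [NormedAddCommGroup G] [NormedSpace ℝ G] [CompleteSpace G]
    {f : P × E → G} {g₁ g₂ : P → E} {p : P} {c : G} (hf : ContDiffAt ℝ 1 f (p, g₁ p))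
    (hinv : (fderiv ℝ (fun v => f (p, v)) (g₁ p)).IsInvertible)
    (hg₁ : ContinuousAt g₁ p) (hg₂ : ContinuousAt g₂ p) (hp : g₁ p = g₂ p)
    (hfg₁ : ∀ u, f (u, g₁ u) = c) (hfg₂ : ∀ u, f (u, g₂ u) = c) : g₁ =ᶠ[𝓝 p] g₂ := by
  have hslice : HasFDerivAt (fun v => f (p, v))
      ((fderiv ℝ f (p, g₁ p)).comp (.inr ℝ P E)) (g₁ p) :=
    HasFDerivAt.comp (g₁ p) (hf.differentiableAt one_ne_zero).hasFDerivAt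
      (hasFDerivAt_prodMk_right p (g₁ p))
  rw [hslice.fderiv] at hinv
  have hiff := hf.eventually_apply_eq_iff_implicitFunction one_ne_zero hinv
  have ht₁ : Tendsto (fun u => (u, g₁ u)) (𝓝 p) (𝓝 (p, g₁ p)) := continuousAt_id.prodMk hg₁
  have ht₂ : Tendsto (fun u => (u, g₂ u)) (𝓝 p) (𝓝 (p, g₁ p)) := hp ▸ continuousAt_id.prodMk hg₂
  filter_upwards [ht₁.eventually hiff, ht₂.eventually hiff] with u h₁ h₂
  exact (h₁.1 (by rw [hfg₁, hfg₁])).symm.trans (h₂.1 (by rw [hfg₂, hfg₁]))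


/-- Let `F¹, F² : ℝ^d → ℝ^d` and `H : ℝ^d × ℝ^d → ℝ` be real analytic, with
`∇_v H(Fⁱ(u), u) = 0` for `i = 1, 2` and all `u`.  If `F¹ = F²` on a nonempty set `A` and
at some `p ∈ A` the Hessian `∇²_v H(F¹(p), p)` is nonsingular, then `F¹ = F²` on `ℝ^d`. -/
theorem analytic_vector_fields_eq_of_conservation_law_nonsingular_hessian
    (d : ℕ)
    (F₁ F₂ : EuclideanSpace ℝ (Fin d) → EuclideanSpace ℝ (Fin d))
    (hF₁ : ∀ x, AnalyticAt ℝ F₁ x) (hF₂ : ∀ x, AnalyticAt ℝ F₂ x)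
    (H : EuclideanSpace ℝ (Fin d) → EuclideanSpace ℝ (Fin d) → ℝ)
    (hH : ∀ p : EuclideanSpace ℝ (Fin d) × EuclideanSpace ℝ (Fin d),
      AnalyticAt ℝ (fun q : EuclideanSpace ℝ (Fin d) × EuclideanSpace ℝ (Fin d) =>
        H q.1 q.2) p)
    (hgrad₁ : ∀ u, gradient (fun v => H v u) (F₁ u) = 0)
    (hgrad₂ : ∀ u, gradient (fun v => H v u) (F₂ u) = 0)
    (A : Set (EuclideanSpace ℝ (Fin d))) (hA : A.Nonempty)
    (hagree : ∀ u ∈ A, F₁ u = F₂ u)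
    (p : EuclideanSpace ℝ (Fin d)) (hp : p ∈ A)
    (hhess : Function.Bijective (fderiv ℝ (gradient (fun v => H v p)) (F₁ p))) :
    F₁ = F₂ := by
  have hinv : (fderiv ℝ (gradient (fun v => H v p)) (F₁ p)).IsInvertible :=
    ⟨(LinearEquiv.ofBijective _ hhess).toContinuousLinearEquiv, by ext1; rfl⟩
  have hgerm : F₁ =ᶠ[𝓝 p] F₂ :=
    eventuallyEq_of_apply_eq_of_isInvertible (analyticAt_gradient_fst hH _).contDiffAt hinv
      (hF₁ p).continuousAt (hF₂ p).continuousAt (hagree p hp) hgrad₁ hgrad₂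
  exact AnalyticOnNhd.eq_of_eventuallyEq (fun x _ => hF₁ x) (fun x _ => hF₂ x) hgerm
end

section
/- Let F₀ : ℝ² → ℝ² be the harmonic oscillator vector field F₀(x, y) = (y, −x), and let H : ℝ² × ℝ² → ℝ be H(v, u) = ½(u·v)² + ½(‖v‖² − ‖u‖²)², where · is the Euclidean inner product and ‖·‖ the Euclidean norm. Let F : ℝ² → ℝ² be any real analytic function satisfying the conservation law ∇_v H(F(u), u) = 0 for all u ∈ ℝ², and suppose F(p) = F₀(p) for some p ≠ (0,0). Then F = F₀ on all of ℝ². In particular, the harmonic oscillator ẋ = y, ẏ = −x is discoverable within real analytic vector fields from any single trajectory avoiding the origin, given the conservation law H. -/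
open scoped InnerProductSpace

/-- The harmonic oscillator vector field `F₀(x, y) = (y, -x)` on `ℝ²`. -/
noncomputable def harmonicOscillator :
    EuclideanSpace ℝ (Fin 2) → EuclideanSpace ℝ (Fin 2) :=
  fun u => (WithLp.equiv 2 (Fin 2 → ℝ)).symm ![u 1, -u 0]

/-- The conservation law `H(v, u) = ½(u·v)² + ½(‖v‖² − ‖u‖²)²`. -/
noncomputable def shoLaw (v u : EuclideanSpace ℝ (Fin 2)) : ℝ :=
  (1 / 2) * ⟪u, v⟫_ℝ ^ 2 + (1 / 2) * (‖v‖ ^ 2 - ‖u‖ ^ 2) ^ 2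

/-- The gradient of `shoLaw` in its first argument is `(u·v) u + 2 (‖v‖² − ‖u‖²) v`. -/
theorem hasGradientAt_shoLaw (v u : EuclideanSpace ℝ (Fin 2)) :
    HasGradientAt (fun v => shoLaw v u)
      (⟪u, v⟫_ℝ • u + (2 * (‖v‖ ^ 2 - ‖u‖ ^ 2)) • v) v := by
  rw [hasGradientAt_iff_hasFDerivAt]
  have h1 : HasFDerivAt (fun v => ⟪u, v⟫_ℝ) (innerSL ℝ u) v := (innerSL ℝ u).hasFDerivAt
  have h2 : HasFDerivAt (fun v : EuclideanSpace ℝ (Fin 2) => ‖v‖ ^ 2) (2 • innerSL ℝ v) v :=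
    (hasStrictFDerivAt_norm_sq v).hasFDerivAt
  refine (((h1.pow 2).const_mul (1 / 2)).add
    (((h2.sub_const (‖u‖ ^ 2)).pow 2).const_mul (1 / 2))).congr_fderiv ?_
  ext w
  simp
  ring

/-- A critical point `v` of `shoLaw · u` lying strictly on the side of the harmonic oscillator
field at `u` is the harmonic oscillator field at `u`. -/
theorem eq_harmonicOscillator_of_gradient_eq_zero {v u : EuclideanSpace ℝ (Fin 2)}
    (hgrad : gradient (fun v => shoLaw v u) v = 0) (hpos : 0 < v 0 * u 1 - v 1 * u 0) :
    v = harmonicOscillator u := by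
  rw [(hasGradientAt_shoLaw v u).gradient] at hgrad
  have e0 := congrArg (fun w : EuclideanSpace ℝ (Fin 2) => w 0) hgrad
  have e1 := congrArg (fun w : EuclideanSpace ℝ (Fin 2) => w 1) hgrad
  simp only [EuclideanSpace.real_norm_sq_eq, PiLp.inner_apply, Fin.sum_univ_two, PiLp.add_apply,
    PiLp.smul_apply, smul_eq_mul, PiLp.zero_apply, RCLike.inner_apply, conj_trivial] at e0 e1
  obtain ⟨x, hx⟩ : ∃ x, x = u 0 := ⟨_, rfl⟩
  obtain ⟨y, hy⟩ : ∃ y, y = u 1 := ⟨_, rfl⟩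
  obtain ⟨a, ha⟩ : ∃ a, a = v 0 := ⟨_, rfl⟩
  obtain ⟨b, hb⟩ : ∃ b, b = v 1 := ⟨_, rfl⟩
  rw [← hx, ← hy, ← ha, ← hb] at e0 e1
  rw [← hx, ← hy, ← ha, ← hb] at hpos
  have hnorm : a ^ 2 + b ^ 2 - (x ^ 2 + y ^ 2) = 0 := by
    have : (a ^ 2 + b ^ 2 - (x ^ 2 + y ^ 2)) * (a * y - b * x) = 0 := by
      linear_combination (y * e0 - x * e1) / 2
    exact (mul_eq_zero.1 this).resolve_right hpos.ne'
  have horth : a * x + b * y = 0 := by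
    have : (a * x + b * y) * (a * y - b * x) = 0 := by
      linear_combination a * e1 - b * e0
    exact (mul_eq_zero.1 this).resolve_right hpos.ne'
  have hcross : a * y - b * x = x ^ 2 + y ^ 2 := by
    have : (a * y - b * x) ^ 2 = (x ^ 2 + y ^ 2) ^ 2 := by
      linear_combination (x ^ 2 + y ^ 2) * hnorm - (a * x + b * y) * horth
    exact (pow_left_inj₀ hpos.le (by positivity) two_ne_zero).1 this
  have hdist : (a - y) ^ 2 + (b + x) ^ 2 = 0 := by
    linear_combination hnorm - 2 * hcross
  have hay : a = y := by nlinarith [sq_nonneg (a - y), sq_nonneg (b + x)]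
  have hbx : b = -x := by nlinarith [sq_nonneg (a - y), sq_nonneg (b + x)]
  ext i
  fin_cases i
  · simp [harmonicOscillator, ← ha, ← hy, hay]
  · simp [harmonicOscillator, ← hb, ← hx, hbx]

theorem analyticAt_harmonicOscillator (u : EuclideanSpace ℝ (Fin 2)) :
    AnalyticAt ℝ harmonicOscillator u := by
  let L : EuclideanSpace ℝ (Fin 2) →ₗ[ℝ] EuclideanSpace ℝ (Fin 2) :=
    { toFun := harmonicOscillator
      map_add' := fun a b => by
        ext i; fin_cases i <;> simp [harmonicOscillator, add_comm]
      map_smul' := fun c a => by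
        ext i; fin_cases i <;> simp [harmonicOscillator] }
  exact L.toContinuousLinearMap.analyticAt u

/-- Any real analytic `F : ℝ² → ℝ²` satisfying the conservation law
`∇_v H(F(u), u) = 0` for all `u`, and agreeing with the harmonic oscillator field `F₀`
at some point `p ≠ 0`, equals `F₀` everywhere.  Hence the harmonic oscillator is
discoverable within real analytic vector fields from any single trajectory avoiding the
origin, given the conservation law `H`. -/
theorem harmonic_oscillator_discoverable_with_law
    (F : EuclideanSpace ℝ (Fin 2) → EuclideanSpace ℝ (Fin 2))
    (hF : ∀ x, AnalyticAt ℝ F x)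
    (hcons : ∀ u, gradient (fun v => shoLaw v u) (F u) = 0)
    (p : EuclideanSpace ℝ (Fin 2)) (hp : p ≠ 0)
    (hFp : F p = harmonicOscillator p) :
    F = harmonicOscillator := by
  have hcont : Continuous F := continuous_iff_continuousAt.2 fun x => (hF x).continuousAt
  have hpos : 0 < F p 0 * p 1 - F p 1 * p 0 := by
    have h : 0 < ‖p‖ ^ 2 := by positivity
    rw [EuclideanSpace.real_norm_sq_eq, Fin.sum_univ_two] at h
    simp only [hFp, harmonicOscillator, WithLp.equiv_symm_apply, Matrix.cons_val_zero,
      Matrix.cons_val_one]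
    linarith
  have hev : ∀ᶠ u in nhds p, 0 < F u 0 * u 1 - F u 1 * u 0 :=
    (isOpen_lt continuous_const (by fun_prop)).mem_nhds hpos
  exact AnalyticOnNhd.eq_of_eventuallyEq (fun x _ => hF x)
    (fun x _ => analyticAt_harmonicOscillator x)
    (hev.mono fun u hu => eq_harmonicOscillator_of_gradient_eq_zero (hcons u) hu)
end

section
/- Let F₀ : ℝ² → ℝ² be F₀(x, y) = (y, −x). Let F : ℝ² → ℝ² be real analytic with skew-symmetric Jacobian, i.e., the derivative DF(u) : ℝ² → ℝ² is a skew-symmetric linear map for every u ∈ ℝ². Assume the conservation law ⟨u, F(u)⟩ = 0 for all u ∈ ℝ² (equivalently ∇_v H(F(u), u) = 0 for H(v,u) = ½(u·v)²), and that F agrees with F₀ on the unit circle {(x,y) : x² + y² = 1}. Then F = F₀ on all of ℝ². -/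
open scoped InnerProductSpace

/-- A differentiable vector field whose derivative is everywhere skew satisfies
`⟪F w - F u, w - u⟫ = 0`. -/
theorem inner_map_sub_map_sub_eq_zero_of_fderiv_skew {E : Type*} [NormedAddCommGroup E]
    [InnerProductSpace ℝ E] {F : E → E} (hF : Differentiable ℝ F)
    (hskew : ∀ u v w : E, ⟪fderiv ℝ F u v, w⟫_ℝ = -⟪v, fderiv ℝ F u w⟫_ℝ) (u w : E) :
    ⟪F w - F u, w - u⟫_ℝ = 0 := by
  have hline (t : ℝ) : HasDerivAt (fun s : ℝ => u + s • (w - u)) (w - u) t := by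
    simpa using ((hasDerivAt_id t).smul_const (w - u)).const_add u
  have hderiv (t : ℝ) :
      HasDerivAt (fun s : ℝ => ⟪F (u + s • (w - u)), w - u⟫_ℝ) 0 t := by
    have h := ((hF (u + t • (w - u))).hasFDerivAt.comp_hasDerivAt t (hline t)).inner ℝ
      (hasDerivAt_const t (w - u))
    have hzero : ⟪fderiv ℝ F (u + t • (w - u)) (w - u), w - u⟫_ℝ = 0 := by
      have := hskew (u + t • (w - u)) (w - u) (w - u)
      rw [real_inner_comm (fderiv ℝ F (u + t • (w - u)) (w - u)) (w - u)] at this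
      linarith
    rw [inner_zero_right, zero_add, hzero] at h
    exact h
  have hconst := is_const_of_deriv_eq_zero (fun t => (hderiv t).differentiableAt)
    (fun t => (hderiv t).deriv) 1 0
  simpa [inner_sub_left, sub_eq_zero] using hconst

/-- Let `F : ℝ² → ℝ²` be real analytic with skew-symmetric Jacobian
(`DF(u)ᵀ = -DF(u)` for all `u`), satisfying the conservation law `⟨u, F(u)⟩ = 0` for all
`u`, and agreeing with `F₀(x,y) = (y, -x)` on the unit circle.  Then `F = F₀` on `ℝ²`. -/
theorem harmonic_oscillator_discoverable_skew_jacobian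
    (F : EuclideanSpace ℝ (Fin 2) → EuclideanSpace ℝ (Fin 2))
    (hF : ∀ x, AnalyticAt ℝ F x)
    (hskew : ∀ u v w : EuclideanSpace ℝ (Fin 2),
      ⟪fderiv ℝ F u v, w⟫_ℝ = -⟪v, fderiv ℝ F u w⟫_ℝ)
    (hcons : ∀ u, ⟪u, F u⟫_ℝ = 0)
    (hcirc : ∀ u : EuclideanSpace ℝ (Fin 2), ‖u‖ = 1 → F u = harmonicOscillator u) :
    F = harmonicOscillator := by
  have hanti (u w : EuclideanSpace ℝ (Fin 2)) : ⟪F w, u⟫_ℝ = -⟪F u, w⟫_ℝ := by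
    have h := inner_map_sub_map_sub_eq_zero_of_fderiv_skew
      (fun x => (hF x).differentiableAt) hskew u w
    simp only [inner_sub_left, inner_sub_right] at h
    have hu := hcons u
    have hw := hcons w
    rw [real_inner_comm] at hu hw
    linarith
  ext w i
  have h := hanti (EuclideanSpace.single i 1) w
  rw [hcirc (EuclideanSpace.single i 1) (by simp)] at h
  fin_cases i <;>
    simpa [harmonicOscillator, PiLp.inner_apply, Fin.sum_univ_two] using h
end

section
/- Let F : ℝ^d → ℝ^d be a real analytic vector field that admits a nonconstant real analytic first integral, i.e., a nonconstant real analytic G : ℝ^d → ℝ with ∇G(x) · F(x) = 0 for all x ∈ ℝ^d. Then for every trajectory of F — every differentiable u : U → ℝ^d on an open connected set U ⊆ ℝ with u'(t) = F(u(t)) for all t — there exists a nonzero real analytic function h : ℝ^d → ℝ vanishing on the image u(U). Consequently, no trajectory of F is a set of uniqueness for real analytic functions, and F is not analytically discoverable from any single trajectory. -/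
open scoped InnerProductSpace

/-- If a real analytic vector field `F : ℝ^d → ℝ^d` admits a nonconstant real
analytic first integral `G` (`∇G(x) · F(x) = 0` for all `x`), then for every trajectory
`u : U → ℝ^d` of `F` on an open connected `U ⊆ ℝ` there is a nonzero real analytic
`h : ℝ^d → ℝ` vanishing on the image `u '' U`; no trajectory of `F` is a set of
uniqueness, and `F` is not analytically discoverable from a single trajectory. -/
theorem no_trajectory_set_of_uniqueness_of_first_integral
    (d : ℕ)
    (F : EuclideanSpace ℝ (Fin d) → EuclideanSpace ℝ (Fin d))
    (hF : ∀ x, AnalyticAt ℝ F x)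
    (G : EuclideanSpace ℝ (Fin d) → ℝ)
    (hG : ∀ x, AnalyticAt ℝ G x)
    (hGnonconst : ¬ ∃ c : ℝ, ∀ x, G x = c)
    (hfirst : ∀ x, ⟪gradient G x, F x⟫_ℝ = 0) :
    ∀ (U : Set ℝ), IsOpen U → IsConnected U →
      ∀ u : ℝ → EuclideanSpace ℝ (Fin d),
        (∀ t ∈ U, HasDerivAt u (F (u t)) t) →
        ∃ h : EuclideanSpace ℝ (Fin d) → ℝ,
          (∀ x, AnalyticAt ℝ h x) ∧ h ≠ 0 ∧ ∀ x ∈ u '' U, h x = 0 := by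
  intro U hUo hUc u hu
  obtain ⟨t₀, ht₀⟩ := hUc.nonempty
  have hderiv : ∀ t ∈ U, HasDerivAt (G ∘ u) 0 t := by
    intro t ht
    have hcomp := (hG (u t)).differentiableAt.hasGradientAt.hasFDerivAt.comp_hasDerivAt t (hu t ht)
    rwa [InnerProductSpace.toDual_apply_apply, hfirst] at hcomp
  refine ⟨fun x => G x - G (u t₀), fun x => (hG x).sub analyticAt_const, fun h0 => ?_, ?_⟩
  · exact hGnonconst ⟨G (u t₀), fun x => sub_eq_zero.mp (congrFun h0 x)⟩
  · rintro _ ⟨t, ht, rfl⟩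
    exact sub_eq_zero.mpr <| hUo.is_const_of_deriv_eq_zero hUc.isPreconnected
      (fun s hs => (hderiv s hs).differentiableAt.differentiableWithinAt)
      (fun s hs => (hderiv s hs).deriv) ht ht₀
end

section
/- Let F : ℝ^d → ℝ^d be continuous and let φ : ℝ × ℝ^d → ℝ^d be a continuous flow satisfying (d/dt) φ(t, x) = F(φ(t, x)) for all t ∈ ℝ and x ∈ ℝ^d. If φ is topologically transitive, then there exists x₀ ∈ ℝ^d such that F is discoverable from the single trajectory t ↦ φ(t, x₀) within the class of continuous functions: every continuous G : ℝ^d → ℝ^d satisfying (d/dt) φ(t, x₀) = G(φ(t, x₀)) for all t ≥ 0 equals F on all of ℝ^d. -/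
/-- A flow is topologically transitive if for all nonempty open `U, V` there is `t > 0`
with `φ_t(U) ∩ V ≠ ∅`. -/
def TopTransitive {X : Type*} [TopologicalSpace X] (φ : ℝ → X → X) : Prop :=
  ∀ U V : Set X, IsOpen U → IsOpen V → U.Nonempty → V.Nonempty →
    ∃ t > (0 : ℝ), ((fun x => φ t x) '' U ∩ V).Nonempty

/-- A continuous topologically transitive flow on a second countable Baire space has a point
with dense forward orbit. -/
theorem TopTransitive.exists_dense_forward_orbit {X : Type*} [TopologicalSpace X] [BaireSpace X]
    [SecondCountableTopology X] [Nonempty X] {φ : ℝ → X → X} (hφ : TopTransitive φ)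
    (hcont : ∀ t, Continuous (φ t)) : ∃ x, Dense ((fun t => φ t x) '' Set.Ici 0) := by
  obtain ⟨B, hBc, hBne, hB⟩ := TopologicalSpace.exists_countable_basis X
  have : Countable B := hBc.to_subtype
  have hdense : Dense (⋂ V : B, ⋃ t ∈ Set.Ioi (0 : ℝ), φ t ⁻¹' (V : Set X)) := by
    refine dense_iInter_of_isOpen
      (fun V => isOpen_biUnion fun t _ => (hB.isOpen V.2).preimage (hcont t)) fun V => ?_
    refine dense_iff_inter_open.2 fun U hU hUne => ?_
    have hVne : (V : Set X).Nonempty :=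
      Set.nonempty_iff_ne_empty.2 fun h => hBne (h ▸ V.2)
    obtain ⟨t, ht, _, ⟨x, hxU, rfl⟩, hxV⟩ := hφ U V hU (hB.isOpen V.2) hUne hVne
    exact ⟨x, hxU, Set.mem_biUnion (show t ∈ Set.Ioi (0 : ℝ) from ht) hxV⟩
  obtain ⟨x, hx⟩ := hdense.nonempty
  refine ⟨x, hB.dense_iff.2 fun V hV _ => ?_⟩
  obtain ⟨t, ht, hxV⟩ := Set.mem_iUnion₂.1 (Set.mem_iInter.1 hx ⟨V, hV⟩)
  exact ⟨φ t x, hxV, t, Set.Ioi_subset_Ici_self ht, rfl⟩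

/-- If `F : ℝ^d → ℝ^d` is continuous and `φ` is a continuous, topologically
transitive flow with `(d/dt) φ(t,x) = F(φ(t,x))`, then there is an `x₀` from whose single
trajectory `F` is discoverable in the class of continuous functions: any continuous `G`
with `(d/dt) φ(t,x₀) = G(φ(t,x₀))` for all `t ≥ 0` equals `F` everywhere. -/
theorem transitive_flow_continuously_discoverable
    (d : ℕ) (F : (Fin d → ℝ) → (Fin d → ℝ)) (hF : Continuous F)
    (φ : ℝ → (Fin d → ℝ) → (Fin d → ℝ))
    (hcont : Continuous fun p : ℝ × (Fin d → ℝ) => φ p.1 p.2)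
    (h0 : ∀ x, φ 0 x = x) (hadd : ∀ s t x, φ (s + t) x = φ s (φ t x))
    (hode : ∀ (t : ℝ) (x : Fin d → ℝ), HasDerivAt (fun s => φ s x) (F (φ t x)) t)
    (htt : TopTransitive φ) :
    ∃ x₀ : Fin d → ℝ, ∀ G : (Fin d → ℝ) → (Fin d → ℝ), Continuous G →
      (∀ t ≥ (0 : ℝ), HasDerivAt (fun s => φ s x₀) (G (φ t x₀)) t) → G = F := by
  obtain ⟨x₀, hx₀⟩ := htt.exists_dense_forward_orbit fun t =>
    hcont.comp (Continuous.prodMk_right t)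
  refine ⟨x₀, fun G hG hGode => hG.ext_on hx₀ hF ?_⟩
  rintro _ ⟨t, ht, rfl⟩
  exact (hGode t ht).unique (hode t x₀)
end

section
/- Let F : ℝ^d → ℝ^d be continuous and let φ : ℝ × ℝ^d → ℝ^d be a continuous flow satisfying (d/dt) φ(t, x) = F(φ(t, x)) for all t ∈ ℝ and x ∈ ℝ^d. Suppose there exists x₀ ∈ ℝ^d such that F is discoverable from the single trajectory of x₀ in the class of continuous functions, i.e., every continuous G : ℝ^d → ℝ^d with (d/dt) φ(t, x₀) = G(φ(t, x₀)) for all t ≥ 0 equals F. Then the forward orbit {φ(t, x₀) : t ≥ 0} is dense in ℝ^d and the flow φ is topologically transitive. -/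
/-- The forward orbit `{φ(t, x) : t ≥ 0}` of a point under a flow. -/
def fwdOrbit {X : Type*} (φ : ℝ → X → X) (x : X) : Set X :=
  {y | ∃ t ≥ (0 : ℝ), φ t x = y}

/-- A flow with a dense forward orbit is topologically transitive. -/
theorem TopTransitive.of_dense_fwdOrbit {X : Type*} [TopologicalSpace X] {φ : ℝ → X → X}
    (hcont : ∀ t, Continuous (φ t)) (h0 : ∀ x, φ 0 x = x)
    (hadd : ∀ s t x, φ (s + t) x = φ s (φ t x)) {x : X} (hx : Dense (fwdOrbit φ x)) :
    TopTransitive φ := by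
  intro U V hU hV hUne ⟨v, hv⟩
  obtain ⟨_, hsU, s, -, rfl⟩ := hx.inter_open_nonempty U hU hUne
  have hne : (φ (s + 1) ⁻¹' V).Nonempty :=
    ⟨φ (-(s + 1)) v, by rwa [Set.mem_preimage, ← hadd, add_neg_cancel, h0]⟩
  obtain ⟨_, htV, t, ht, rfl⟩ := hx.inter_open_nonempty _ (hV.preimage (hcont _)) hne
  refine ⟨1 + t, by linarith, φ (1 + t) (φ s x), ⟨φ s x, hsU, rfl⟩, ?_⟩
  rw [Set.mem_preimage, ← hadd] at htV
  rw [← hadd]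
  convert htV using 2
  ring

/-- If the values on `s` determine a continuous function within all continuous functions, then the
nonempty set `s` is dense. -/
theorem dense_of_continuous_eqOn_imp_eq {E : Type*} [NormedAddCommGroup E] [NormedSpace ℝ E]
    {s : Set E} (hs : s.Nonempty) {F : E → E} (hF : Continuous F)
    (h : ∀ G : E → E, Continuous G → Set.EqOn G F s → G = F) : Dense s := by
  obtain ⟨x, hx⟩ := hs
  intro y
  by_contra hy
  have hG := h (fun z => F z + Metric.infDist z s • (y - x))
    (hF.add ((Metric.continuous_infDist_pt s).smul continuous_const))
    (fun z hz => by simp [Metric.infDist_zero_of_mem hz])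
  have hzero : Metric.infDist y s • (y - x) = 0 := by simpa using congrFun hG y
  rcases smul_eq_zero.mp hzero with hd | hd
  · exact hy ((Metric.mem_closure_iff_infDist_zero ⟨x, hx⟩).mpr hd)
  · exact hy (sub_eq_zero.mp hd ▸ subset_closure hx)

/-- If `F : ℝ^d → ℝ^d` is continuous with continuous flow `φ`, and `F` is
discoverable in the class of continuous functions from the single trajectory of some
`x₀` (every continuous `G` solving the ODE along that trajectory equals `F`), then the
forward orbit of `x₀` is dense in `ℝ^d` and the flow is topologically transitive. -/
theorem continuously_discoverable_implies_transitive
    (d : ℕ) (F : (Fin d → ℝ) → (Fin d → ℝ)) (hF : Continuous F)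
    (φ : ℝ → (Fin d → ℝ) → (Fin d → ℝ))
    (hcont : Continuous fun p : ℝ × (Fin d → ℝ) => φ p.1 p.2)
    (h0 : ∀ x, φ 0 x = x) (hadd : ∀ s t x, φ (s + t) x = φ s (φ t x))
    (hode : ∀ (t : ℝ) (x : Fin d → ℝ), HasDerivAt (fun s => φ s x) (F (φ t x)) t)
    (x₀ : Fin d → ℝ)
    (hdisc : ∀ G : (Fin d → ℝ) → (Fin d → ℝ), Continuous G →
      (∀ t ≥ (0 : ℝ), HasDerivAt (fun s => φ s x₀) (G (φ t x₀)) t) → G = F) :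
    Dense (fwdOrbit φ x₀) ∧ TopTransitive φ := by
  have hdense : Dense (fwdOrbit φ x₀) := by
    refine dense_of_continuous_eqOn_imp_eq ⟨φ 0 x₀, 0, le_rfl, rfl⟩ hF fun G hG hGF => ?_
    refine hdisc G hG fun t ht => ?_
    rw [hGF ⟨t, ht, rfl⟩]
    exact hode t x₀
  exact ⟨hdense, .of_dense_fwdOrbit (fun t => hcont.comp (by fun_prop : Continuous fun x => (t, x)))
    h0 hadd hdense⟩
end

section
/- Let F : ℝ^d → ℝ^d be real analytic and let u : [0, ∞) → ℝ^d be differentiable with u'(t) = F(u(t)) for all t ≥ 0. Let A = closure({u(t) : t ≥ 0}) be the closure of the forward trajectory. If the Hausdorff dimension of A is strictly greater than d − 1, then F is discoverable from the single trajectory u within real analytic functions: every real analytic G : ℝ^d → ℝ^d with u'(t) = G(u(t)) for all t ≥ 0 equals F on all of ℝ^d. In particular, a system chaotic on an attractor of Hausdorff dimension greater than d − 1, restricted to its dense orbit, is analytically discoverable from that single trajectory. -/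
open scoped ENNReal

open Set Filter Topology Module
open scoped NNReal ContDiff

section ZeroSets

variable {E : Type*} [NormedAddCommGroup E] [NormedSpace ℝ E]
  {V : Type*} [NormedAddCommGroup V] [NormedSpace ℝ V]

/-- The kernel of a nonzero functional has Hausdorff dimension at most `finrank ℝ E - 1`. -/
theorem dimH_ker_le [FiniteDimensional ℝ E] {φ : StrongDual ℝ E} (hφ : φ ≠ 0) :
    dimH {y | φ y = 0} ≤ (finrank ℝ E : ℝ≥0∞) - 1 := by
  let K := LinearMap.ker (φ : E →ₗ[ℝ] ℝ)
  have hlt : finrank ℝ K < finrank ℝ E := by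
    refine Submodule.finrank_lt fun htop => hφ ?_
    ext y
    have hy : y ∈ K := htop ▸ Submodule.mem_top
    simpa [K] using hy
  have hrange : {y | φ y = 0} ⊆ range K.subtypeL := fun y hy => ⟨⟨y, hy⟩, rfl⟩
  calc dimH {y | φ y = 0} ≤ dimH (range K.subtypeL) := dimH_mono hrange
    _ ≤ finrank ℝ K := K.subtypeL.contDiff.dimH_range_le
    _ ≤ ((finrank ℝ E - 1 : ℕ) : ℝ≥0∞) := by
      exact_mod_cast Nat.le_sub_one_of_lt hlt
    _ = _ := by simp

/-- Near a point where its strict derivative is a nonzero functional, the zero set of a real-valued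
function has Hausdorff dimension at most `finrank ℝ E - 1`: the projection onto the kernel of the
derivative is antilipschitz on it. -/
theorem HasStrictFDerivAt.exists_nhds_dimH_zeros_le_of_real [FiniteDimensional ℝ E]
    {g : E → ℝ} {φ : StrongDual ℝ E} {x : E} (hg : HasStrictFDerivAt g φ x) (hφ : φ ≠ 0) :
    ∃ U ∈ 𝓝 x, dimH (U ∩ {y | g y = 0}) ≤ (finrank ℝ E : ℝ≥0∞) - 1 := by
  obtain ⟨w, hw⟩ := ContinuousLinearMap.exists_ne_zero hφ
  set v : E := (φ w)⁻¹ • w with hv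
  have hφv : φ v = 1 := by simp [hv, hw]
  have hv0 : 0 < ‖v‖ := norm_pos_iff.2 fun h => by simp [h] at hφv
  have hε : (0 : ℝ) < (2 * ‖v‖)⁻¹ := by positivity
  obtain ⟨U, hU, hlin⟩ := hg.approximates_deriv_on_nhds (c := ⟨(2 * ‖v‖)⁻¹, hε.le⟩) (Or.inr hε)
  refine ⟨U, hU, ?_⟩
  set S := U ∩ {y | g y = 0}
  let P : E → E := fun y => y - φ y • v
  have hP : AntilipschitzWith 2 (S.domRestrict P) := by
    refine AntilipschitzWith.of_le_mul_dist ?_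
    rintro ⟨y, hyU, hy⟩ ⟨z, hzU, hz⟩
    have hgy : g y = 0 := hy
    have hgz : g z = 0 := hz
    have happ : |φ (y - z)| ≤ (2 * ‖v‖)⁻¹ * ‖y - z‖ := by
      have := hlin y hyU z hzU
      rw [hgy, hgz, sub_zero, zero_sub, norm_neg] at this
      exact this
    have hsplit : y - z = (P y - P z) + φ (y - z) • v := by
      simp only [P, map_sub, sub_smul]
      abel
    have hbound : ‖y - z‖ ≤ ‖P y - P z‖ + |φ (y - z)| * ‖v‖ := by
      calc ‖y - z‖ = ‖(P y - P z) + φ (y - z) • v‖ := by rw [← hsplit]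
        _ ≤ _ := (norm_add_le _ _).trans_eq (by rw [norm_smul, Real.norm_eq_abs])
    have hhalf : |φ (y - z)| * ‖v‖ ≤ ‖y - z‖ / 2 := by
      calc |φ (y - z)| * ‖v‖ ≤ (2 * ‖v‖)⁻¹ * ‖y - z‖ * ‖v‖ := by gcongr
        _ = ‖y - z‖ / 2 := by field_simp
    simp only [Subtype.dist_eq, domRestrict_apply, dist_eq_norm, NNReal.coe_ofNat]
    linarith
  calc dimH S = dimH (univ : Set S) := by
        rw [← (isometry_subtype_coe (s := S)).dimH_image, image_univ, Subtype.range_coe]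
    _ ≤ dimH (S.domRestrict P '' univ) := hP.le_dimH_image univ
    _ ≤ dimH {y | φ y = 0} := dimH_mono <| by
        rintro _ ⟨y, -, rfl⟩
        simp [P, domRestrict_apply, hφv]
    _ ≤ _ := dimH_ker_le hφ

/-- Near a point where its strict derivative is nonzero, the zero set of a function has Hausdorff
dimension at most `finrank ℝ E - 1`. -/
theorem HasStrictFDerivAt.exists_nhds_dimH_zeros_le [FiniteDimensional ℝ E]
    {g : E → V} {g' : E →L[ℝ] V} {x : E} (hg : HasStrictFDerivAt g g' x) (hg' : g' ≠ 0) :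
    ∃ U ∈ 𝓝 x, dimH (U ∩ {y | g y = 0}) ≤ (finrank ℝ E : ℝ≥0∞) - 1 := by
  obtain ⟨w, hw⟩ := ContinuousLinearMap.exists_ne_zero hg'
  obtain ⟨ψ, hψ⟩ := SeparatingDual.exists_ne_zero (R := ℝ) hw
  obtain ⟨U, hU, hle⟩ := (ψ.hasStrictFDerivAt.comp x hg).exists_nhds_dimH_zeros_le_of_real
    fun h => hψ (by simpa using DFunLike.congr_fun h w)
  refine ⟨U, hU, (dimH_mono ?_).trans hle⟩
  rintro y ⟨hyU, hy⟩
  have hgy : g y = 0 := hy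
  exact ⟨hyU, by simp [hgy]⟩

/-- The set of zeros at which a differentiable function is strictly differentiable with nonzero
derivative has Hausdorff dimension at most `finrank ℝ E - 1`. -/
theorem dimH_regular_zeros_le [FiniteDimensional ℝ E] {g : E → V}
    (hg : ∀ x, HasStrictFDerivAt g (fderiv ℝ g x) x) :
    dimH {x | g x = 0 ∧ fderiv ℝ g x ≠ 0} ≤ (finrank ℝ E : ℝ≥0∞) - 1 := by
  by_contra! hlt
  obtain ⟨x, ⟨-, hx⟩, hloc⟩ := exists_mem_nhdsWithin_lt_dimH_of_lt_dimH hlt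
  obtain ⟨U, hU, hle⟩ := (hg x).exists_nhds_dimH_zeros_le hx
  have hmem : U ∩ {y | g y = 0} ∈ 𝓝[{x | g x = 0 ∧ fderiv ℝ g x ≠ 0}] x :=
    inter_mem (mem_nhdsWithin_of_mem_nhds hU)
      (mem_of_superset self_mem_nhdsWithin fun y hy => hy.1)
  exact (hloc _ hmem).not_ge hle

/-- An analytic function all of whose iterated derivatives vanish at a point vanishes near it. -/
theorem AnalyticAt.eventuallyEq_zero_of_iteratedFDeriv_eq_zero [CompleteSpace V]
    {f : E → V} {x : E} (hf : AnalyticAt ℝ f x) (h : ∀ n, iteratedFDeriv ℝ n f x = 0) :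
    f =ᶠ[𝓝 x] 0 := by
  obtain ⟨p, r, hp⟩ := hf
  filter_upwards [Metric.eball_mem_nhds x hp.r_pos] with y hy
  have hy' : y - x ∈ Metric.eball (0 : E) r := by
    simpa [edist_eq_enorm_sub] using hy
  have hsum := hp.hasSum_iteratedFDeriv hy'
  simp only [h, zero_apply, smul_zero, add_sub_cancel] at hsum
  exact hsum.unique hasSum_zero

/-- The zero set of an analytic function that does not vanish identically has Hausdorff dimension
at most `finrank ℝ E - 1`. -/
theorem AnalyticOnNhd.dimH_zeros_le [FiniteDimensional ℝ E] [CompleteSpace V] {f : E → V}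
    (hf : AnalyticOnNhd ℝ f univ) (hne : f ≠ 0) :
    dimH {x | f x = 0} ≤ (finrank ℝ E : ℝ≥0∞) - 1 := by
  have hcover : {x | f x = 0} ⊆
      ⋃ n, {x | iteratedFDeriv ℝ n f x = 0 ∧ fderiv ℝ (iteratedFDeriv ℝ n f) x ≠ 0} := by
    intro x hx
    by_contra hnot
    simp only [mem_iUnion, mem_ofPred_eq, not_exists, not_and, not_not] at hnot
    refine hne (hf.eq_of_eventuallyEq analyticOnNhd_const (z₀ := x) <|
      (hf x (mem_univ x)).eventuallyEq_zero_of_iteratedFDeriv_eq_zero fun n => ?_)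
    induction n with
    | zero =>
      rw [← norm_eq_zero, norm_iteratedFDeriv_zero, norm_eq_zero]
      exact hx
    | succ n ih =>
      rw [← norm_eq_zero, ← norm_fderiv_iteratedFDeriv]
      exact (congrArg norm (hnot n ih)).trans ContinuousLinearMap.opNorm_zero
  refine (dimH_mono hcover).trans ?_
  rw [dimH_iUnion]
  exact iSup_le fun n => dimH_regular_zeros_le fun x =>
    (hf.iteratedFDeriv n x (mem_univ x)).hasStrictFDerivAt

end ZeroSets

/-- Let `F : ℝ^d → ℝ^d` be real analytic and `u : [0,∞) → ℝ^d` a trajectory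
of `F`.  If the closure `A` of the forward trajectory has Hausdorff dimension strictly
greater than `d - 1`, then `F` is discoverable from the single trajectory `u` within real
analytic functions: every real analytic `G` with `u' t = G (u t)` for all `t ≥ 0` equals
`F` on all of `ℝ^d`. -/
theorem analytic_discoverable_of_trajectory_closure_large_dimH
    (d : ℕ)
    (F : EuclideanSpace ℝ (Fin d) → EuclideanSpace ℝ (Fin d))
    (hF : ∀ x, AnalyticAt ℝ F x)
    (u : ℝ → EuclideanSpace ℝ (Fin d))
    (hode : ∀ t ≥ (0 : ℝ), HasDerivAt u (F (u t)) t)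
    (hdim : (d : ℝ≥0∞) - 1 < dimH (closure (u '' Set.Ici (0 : ℝ)))) :
    ∀ G : EuclideanSpace ℝ (Fin d) → EuclideanSpace ℝ (Fin d),
      (∀ x, AnalyticAt ℝ G x) →
      (∀ t ≥ (0 : ℝ), HasDerivAt u (G (u t)) t) → G = F := by
  intro G hG hodeG
  by_contra hne
  have hanalytic : AnalyticOnNhd ℝ (G - F) univ := fun x _ => (hG x).sub (hF x)
  have hsub : closure (u '' Ici (0 : ℝ)) ⊆ {x | (G - F) x = 0} := by
    refine closure_minimal ?_ (isClosed_eq (continuousOn_univ.1 hanalytic.continuousOn)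
      continuous_const)
    rintro _ ⟨t, ht, rfl⟩
    exact sub_eq_zero.2 ((hodeG t ht).unique (hode t ht))
  refine hdim.not_ge ((dimH_mono hsub).trans ?_)
  simpa using hanalytic.dimH_zeros_le (sub_ne_zero.2 hne)
end

section
/- Let F : ℝ^d → ℝ^d be real analytic, let n ∈ ℕ, and let u₁, …, uₙ be trajectories of F (differentiable u_i : U_i → ℝ^d on open sets U_i ⊆ ℝ with u_i'(t) = F(u_i(t))). Suppose that for each i there exists a nonzero real analytic function g_i : ℝ^d → ℝ vanishing on the closure of the image u_i(U_i) (i.e., each trajectory closure is a set of non-uniqueness for real analytic functions). Then there exists a nonzero real analytic vector field G : ℝ^d → ℝ^d vanishing on all n trajectory images; consequently F + G ≠ F also satisfies u_i'(t) = (F + G)(u_i(t)) for all i and t, and F is not discoverable from the trajectories u₁, …, uₙ within real analytic functions. -/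
open scoped Topology

/-- The product of two nonzero real analytic functions is nonzero. -/
theorem AnalyticOnNhd.mul_ne_zero_of_ne_zero {E : Type*} [NormedAddCommGroup E] [NormedSpace ℝ E]
    {f g : E → ℝ} (hf : AnalyticOnNhd ℝ f Set.univ) (hg : AnalyticOnNhd ℝ g Set.univ)
    (hf0 : f ≠ 0) (hg0 : g ≠ 0) : f * g ≠ 0 := by
  intro h
  obtain ⟨x, hx⟩ := Function.ne_iff.mp hf0
  have hgx : g =ᶠ[𝓝 x] 0 := by
    filter_upwards [(hf x trivial).continuousAt.eventually_ne hx] with y hy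
    exact (mul_eq_zero.mp (congrFun h y)).resolve_left hy
  exact hg0 (hg.eq_of_eventuallyEq (fun _ _ => analyticAt_const) hgx)

/-- A finite product of nonzero real analytic functions is nonzero. -/
theorem AnalyticOnNhd.finset_prod_ne_zero {E ι : Type*} [NormedAddCommGroup E] [NormedSpace ℝ E]
    {f : ι → E → ℝ} (s : Finset ι) (hf : ∀ i, AnalyticOnNhd ℝ (f i) Set.univ)
    (hf0 : ∀ i, f i ≠ 0) : ∏ i ∈ s, f i ≠ 0 := by
  classical
  induction s using Finset.induction_on with
  | empty => simp
  | insert i s hi ih =>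
    rw [Finset.prod_insert hi]
    exact (hf i).mul_ne_zero_of_ne_zero
      (fun x hx => s.analyticAt_prod fun j _ => hf j x hx) (hf0 i) ih


/-- Let `F : ℝ^d → ℝ^d` (`d ≥ 1`) be real analytic with trajectories
`u₁, …, uₙ` on open sets `U i ⊆ ℝ`.  If for each `i` some nonzero real analytic
`gᵢ : ℝ^d → ℝ` vanishes on the closure of the image of `u i` (each trajectory closure is
a set of non-uniqueness), then there is a nonzero real analytic vector field `G`
vanishing on all `n` trajectory images; `F + G ≠ F` also solves all the trajectory ODEs,
so `F` is not discoverable from `u₁, …, uₙ` within real analytic functions. -/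
theorem not_discoverable_of_trajectory_closures_nonunique
    (d : ℕ) (hd : 0 < d)
    (F : EuclideanSpace ℝ (Fin d) → EuclideanSpace ℝ (Fin d))
    (hF : ∀ x, AnalyticAt ℝ F x)
    (n : ℕ) (U : Fin n → Set ℝ) (hU : ∀ i, IsOpen (U i))
    (u : Fin n → ℝ → EuclideanSpace ℝ (Fin d))
    (hode : ∀ i, ∀ t ∈ U i, HasDerivAt (u i) (F (u i t)) t)
    (hnonuniq : ∀ i, ∃ g : EuclideanSpace ℝ (Fin d) → ℝ,
      (∀ x, AnalyticAt ℝ g x) ∧ g ≠ 0 ∧ ∀ x ∈ closure (u i '' U i), g x = 0) :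
    ∃ G : EuclideanSpace ℝ (Fin d) → EuclideanSpace ℝ (Fin d),
      (∀ x, AnalyticAt ℝ G x) ∧ G ≠ 0 ∧
      (∀ i, ∀ x ∈ u i '' U i, G x = 0) ∧
      (∀ i, ∀ t ∈ U i, HasDerivAt (u i) ((F + G) (u i t)) t) ∧
      F + G ≠ F := by
  choose g hg hg0 hgz using hnonuniq
  set v : EuclideanSpace ℝ (Fin d) := EuclideanSpace.single ⟨0, hd⟩ 1
  have hv : v ≠ 0 := by simp [v]
  have hp := AnalyticOnNhd.finset_prod_ne_zero Finset.univ (fun i x _ => hg i x) hg0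
  have hG0 : (fun x => (∏ i, g i) x • v) ≠ 0 := by
    obtain ⟨x, hx⟩ := Function.ne_iff.mp hp
    exact Function.ne_iff.mpr ⟨x, smul_ne_zero hx hv⟩
  have hGz : ∀ i, ∀ x ∈ u i '' U i, (∏ i, g i) x • v = 0 := fun i x hx => by
    rw [Finset.prod_apply,
      Finset.prod_eq_zero (Finset.mem_univ i) (hgz i x (subset_closure hx)), zero_smul]
  refine ⟨fun x => (∏ i, g i) x • v,
    fun x => (Finset.univ.analyticAt_prod fun i _ => hg i x).smul analyticAt_const,
    hG0, hGz, fun i t ht => ?_, fun h => hG0 (add_eq_left.mp h)⟩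
  rw [Pi.add_apply, hGz i _ (Set.mem_image_of_mem _ ht), add_zero]
  exact hode i t ht
end

section
/- Define F₁, F₂ : ℝ² → ℝ² by F₁(x, y) = (y, −x) and F₂(x, y) = (y(x² + y²), −x(x² + y²)), and define u : ℝ → ℝ² by u(t) = (cos t, −sin t). Then u is differentiable with u'(t) = F₁(u(t)) and u'(t) = F₂(u(t)) for all t ∈ ℝ, and F₁ ≠ F₂ (e.g., F₁(2,0) ≠ F₂(2,0)). Hence the simple harmonic oscillator F₁ is not identifiable from the trajectory u within the class of real analytic vector fields on ℝ². -/
/-- The simple harmonic oscillator field `F₁(x, y) = (y, -x)`. -/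
def shoField : ℝ × ℝ → ℝ × ℝ := fun p => (p.2, -p.1)

/-- The alternative field `F₂(x, y) = (y(x² + y²), -x(x² + y²))`. -/
def shoFieldAlt : ℝ × ℝ → ℝ × ℝ :=
  fun p => (p.2 * (p.1 ^ 2 + p.2 ^ 2), -(p.1 * (p.1 ^ 2 + p.2 ^ 2)))

/-- The circular trajectory `u(t) = (cos t, -sin t)`. -/
noncomputable def circTraj : ℝ → ℝ × ℝ := fun t => (Real.cos t, -Real.sin t)

theorem hasDerivAt_circTraj (t : ℝ) : HasDerivAt circTraj (shoField (circTraj t)) t :=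
  (Real.hasDerivAt_cos t).prodMk (Real.hasDerivAt_sin t).neg

/-- The two fields agree on the unit circle, which contains the trajectory. -/
theorem shoFieldAlt_circTraj (t : ℝ) : shoFieldAlt (circTraj t) = shoField (circTraj t) := by
  simp [shoFieldAlt, shoField, circTraj]

theorem hasDerivAt_circTraj_alt (t : ℝ) :
    HasDerivAt circTraj (shoFieldAlt (circTraj t)) t := by
  rw [shoFieldAlt_circTraj]
  exact hasDerivAt_circTraj t

theorem shoField_ne_shoFieldAlt : shoField ≠ shoFieldAlt := by
  intro h
  have h2 := congrArg Prod.snd (congrFun h (2, 0))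
  norm_num [shoField, shoFieldAlt] at h2

theorem analyticAt_shoFieldAlt (p : ℝ × ℝ) : AnalyticAt ℝ shoFieldAlt p := by
  have hx : AnalyticAt ℝ (fun q : ℝ × ℝ => q.1) p := analyticAt_fst
  have hy : AnalyticAt ℝ (fun q : ℝ × ℝ => q.2) p := analyticAt_snd
  have hr := (hx.pow 2).add (hy.pow 2)
  exact (hy.mul hr).prod (hx.mul hr).neg

/-- `u(t) = (cos t, -sin t)` is a trajectory of both `F₁(x,y) = (y, -x)` and
`F₂(x,y) = (y(x²+y²), -x(x²+y²))`, yet `F₁ ≠ F₂`; hence the simple harmonic oscillator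
`F₁` is not identifiable from the trajectory `u` within real analytic vector fields. -/
theorem sho_not_identifiable :
    (∀ t : ℝ, HasDerivAt circTraj (shoField (circTraj t)) t) ∧
    (∀ t : ℝ, HasDerivAt circTraj (shoFieldAlt (circTraj t)) t) ∧
    shoField ≠ shoFieldAlt ∧
    ¬ (∀ G : ℝ × ℝ → ℝ × ℝ, (∀ p, AnalyticAt ℝ G p) →
        (∀ t : ℝ, HasDerivAt circTraj (G (circTraj t)) t) → G = shoField) := by
  exact ⟨hasDerivAt_circTraj, hasDerivAt_circTraj_alt, shoField_ne_shoFieldAlt, fun h =>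
    shoField_ne_shoFieldAlt (h shoFieldAlt analyticAt_shoFieldAlt hasDerivAt_circTraj_alt).symm⟩
end

section
/- Fix ε < 0 and define γ = {(e^{εt} cos t, e^{εt} sin t) : t ≥ 0} ⊆ ℝ². If f : ℝ² → ℝ is real analytic and f vanishes on γ, then f is identically zero on ℝ². In particular, the linear spiral system du/dt = (−u₂ + εu₁, u₁ + εu₂), which has no dense trajectory, is nevertheless analytically discoverable from any single trajectory. -/
open Filter Topology in
/-- The radii at which an inward spiral crosses the ray of angle `θ` accumulate at the origin. -/
theorem tendsto_exp_mul_add_two_pi_mul_nhdsNE {ε : ℝ} (hε : ε < 0) (θ : ℝ) :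
    Tendsto (fun n : ℕ => Real.exp (ε * (θ + n * (2 * Real.pi)))) atTop (𝓝[≠] 0) := by
  refine tendsto_nhdsWithin_iff.2 ⟨?_, .of_forall fun n => (Real.exp_pos _).ne'⟩
  refine Real.tendsto_exp_atBot.comp (Tendsto.const_mul_atTop_of_neg hε ?_)
  exact tendsto_atTop_add_const_left _ _
    (tendsto_natCast_atTop_atTop.atTop_mul_const Real.two_pi_pos)

open Filter Topology in
/-- An analytic function vanishing on an inward spiral vanishes on every line through the
origin. -/
theorem eq_zero_on_line_of_eq_zero_on_spiral {ε : ℝ} (hε : ε < 0) {f : ℝ × ℝ → ℝ}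
    (hf : ∀ p, AnalyticAt ℝ f p)
    (hvan : ∀ t : ℝ, 0 ≤ t →
      f (Real.exp (ε * t) * Real.cos t, Real.exp (ε * t) * Real.sin t) = 0) (r θ : ℝ) :
    f (r * Real.cos θ, r * Real.sin θ) = 0 := by
  have hg : AnalyticOnNhd ℝ (fun r : ℝ => f (r * Real.cos θ, r * Real.sin θ)) Set.univ :=
    fun x _ => (hf _).comp (f := fun r : ℝ => (r * Real.cos θ, r * Real.sin θ)) (by fun_prop)
  have ht : Tendsto (fun n : ℕ => θ + n * (2 * Real.pi)) atTop atTop :=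
    tendsto_atTop_add_const_left _ _
      (tendsto_natCast_atTop_atTop.atTop_mul_const Real.two_pi_pos)
  have hfreq : ∃ᶠ r in 𝓝[≠] (0 : ℝ), f (r * Real.cos θ, r * Real.sin θ) = 0 := by
    refine (tendsto_exp_mul_add_two_pi_mul_nhdsNE hε θ).frequently (Eventually.frequently ?_)
    filter_upwards [ht.eventually_ge_atTop 0] with n hn
    simpa only [Real.cos_add_nat_mul_two_pi, Real.sin_add_nat_mul_two_pi] using hvan _ hn
  exact hg.eqOn_zero_of_preconnected_of_frequently_eq_zero isPreconnected_univ
    (Set.mem_univ 0) hfreq (Set.mem_univ r)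

/-- Fix `ε < 0` and let `γ = {(e^{εt} cos t, e^{εt} sin t) : t ≥ 0} ⊆ ℝ²`.
Any real analytic `f : ℝ² → ℝ` vanishing on `γ` is identically zero, i.e. the inward
spiral trajectory of the linear system `u' = (-u₂ + εu₁, u₁ + εu₂)` is a set of
uniqueness for real analytic functions. -/
theorem spiral_trajectory_set_of_uniqueness
    (ε : ℝ) (hε : ε < 0)
    (f : ℝ × ℝ → ℝ) (hf : ∀ p, AnalyticAt ℝ f p)
    (hvan : ∀ t : ℝ, 0 ≤ t →
      f (Real.exp (ε * t) * Real.cos t, Real.exp (ε * t) * Real.sin t) = 0) :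
    f = 0 := by
  funext p
  have h := eq_zero_on_line_of_eq_zero_on_spiral hε hf hvan
    ‖(⟨p.1, p.2⟩ : ℂ)‖ (Complex.arg ⟨p.1, p.2⟩)
  rwa [Complex.norm_mul_cos_arg, Complex.norm_mul_sin_arg] at h
end

section
/- Define F₁, F₂ : ℝ² → ℝ² by F₁(x, y) = (y, 0) and F₂(x, y) = (y²/2, 0), let H : ℝ² × ℝ² → ℝ be H(v, u) = ½ v₂², let M = {(x, 0) : x ∈ ℝ} be the x-axis, and let p = (0, 0). Then: (i) F₁ = F₂ on M; (ii) ∇_v H(F_i(u), u) = 0 for i = 1, 2 and all u ∈ ℝ²; (iii) the kernel of the Hessian C = ∇²_v H(F₁(p), p) equals the span of (1, 0), which equals the tangent space to M at p; yet (iv) F₁ ≠ F₂. Hence hypotheses (1)–(3) of the uniqueness theorem for vector fields with (skew-)symmetric Jacobian do not suffice without the symmetry assumption on the Jacobian. -/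
/-- `F₁(x, y) = (y, 0)`. -/
noncomputable def cexF₁ : EuclideanSpace ℝ (Fin 2) → EuclideanSpace ℝ (Fin 2) :=
  fun u => (WithLp.equiv 2 (Fin 2 → ℝ)).symm ![u 1, 0]

/-- `F₂(x, y) = (y²/2, 0)`. -/
noncomputable def cexF₂ : EuclideanSpace ℝ (Fin 2) → EuclideanSpace ℝ (Fin 2) :=
  fun u => (WithLp.equiv 2 (Fin 2 → ℝ)).symm ![u 1 ^ 2 / 2, 0]

/-- `H(v, u) = ½ v₂²`. -/
noncomputable def cexH (v _u : EuclideanSpace ℝ (Fin 2)) : ℝ := (1 / 2) * v 1 ^ 2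

/-- The x-axis `M = {(x, 0) : x ∈ ℝ}`, equal (as a set) to its tangent space
`span{(1,0)}` at any of its points. -/
def cexM : Set (EuclideanSpace ℝ (Fin 2)) := {u | u 1 = 0}

/-- The gradient of `v ↦ H(v, u)` at `v` is `(0, v₂)`. -/
theorem hasGradientAt_cexH (u v : EuclideanSpace ℝ (Fin 2)) :
    HasGradientAt (fun w => cexH w u) (EuclideanSpace.single 1 (v 1)) v := by
  rw [hasGradientAt_iff_hasFDerivAt]
  have hproj : HasFDerivAt (fun w : EuclideanSpace ℝ (Fin 2) => w 1)
      (EuclideanSpace.proj 1 : EuclideanSpace ℝ (Fin 2) →L[ℝ] ℝ) v :=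
    (EuclideanSpace.proj 1 : EuclideanSpace ℝ (Fin 2) →L[ℝ] ℝ).hasFDerivAt
  refine ((hproj.pow 2).const_mul (1 / 2)).congr_fderiv ?_
  ext w
  simp [EuclideanSpace.inner_single_left]
  ring

/-- The gradient of `v ↦ H(v, u)` as a continuous linear map. -/
theorem gradient_cexH (u : EuclideanSpace ℝ (Fin 2)) :
    gradient (fun v => cexH v u) =
      (EuclideanSpace.proj 1 : EuclideanSpace ℝ (Fin 2) →L[ℝ] ℝ).smulRight
        (EuclideanSpace.single 1 (1 : ℝ)) := by
  funext v
  rw [(hasGradientAt_cexH u v).gradient]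
  ext i
  fin_cases i <;> simp

/-- For `F₁(x,y) = (y,0)`, `F₂(x,y) = (y²/2,0)`, `H(v,u) = ½v₂²`, `M` the
x-axis and `p = (0,0)`: (i) `F₁ = F₂` on `M`; (ii) `∇_v H(Fᵢ(u), u) = 0` for `i = 1, 2`
and all `u`; (iii) the kernel of the Hessian `C = ∇²_v H(F₁(p), p)` equals
`span{(1,0)}`, the tangent space to `M` at `p`; yet (iv) `F₁ ≠ F₂`.  So hypotheses
(1)–(3) of the symmetric-Jacobian uniqueness theorem do not suffice without the
(skew-)symmetry assumption on the Jacobian. -/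
theorem nilpotent_counterexample :
    (∀ u ∈ cexM, cexF₁ u = cexF₂ u) ∧
    (∀ u, gradient (fun v => cexH v u) (cexF₁ u) = 0) ∧
    (∀ u, gradient (fun v => cexH v u) (cexF₂ u) = 0) ∧
    ({v : EuclideanSpace ℝ (Fin 2) |
        fderiv ℝ (gradient (fun w => cexH w 0)) (cexF₁ 0) v = 0} = cexM) ∧
    cexF₁ ≠ cexF₂ := by
  refine ⟨fun u hu => ?_, fun u => ?_, fun u => ?_, ?_, fun h => ?_⟩
  · have hu' : u 1 = 0 := hu
    simp [cexF₁, cexF₂, hu']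
  · simp [gradient_cexH, cexF₁]
  · simp [gradient_cexH, cexF₂]
  · ext v
    rw [gradient_cexH, Set.mem_ofPred_eq, ContinuousLinearMap.fderiv]
    simp [cexM]
  · have h₀ := congrArg (fun w => w 0) (congrFun h (EuclideanSpace.single 1 1))
    norm_num [cexF₁, cexF₂] at h₀
end

section
/- Let X be a nonempty complete separable metric space and φ : ℝ × X → X a continuous, topologically transitive flow. If X = ⋃_{i=1}^n closure(Orb(x_i)) for finitely many points x₁, …, xₙ ∈ X, where Orb(x) = {φ(t, x) : t ≥ 0}, then there exists an index i such that Orb(x_i) is dense in X (so a single one of the given trajectories suffices for discovery). -/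
/-- The closure of a forward orbit is forward invariant. -/
theorem mapsTo_closure_fwdOrbit {X : Type*} [TopologicalSpace X] {φ : ℝ → X → X}
    (hcont : ∀ t, Continuous (φ t)) (hadd : ∀ s t x, φ (s + t) x = φ s (φ t x))
    (x : X) {t : ℝ} (ht : 0 ≤ t) :
    Set.MapsTo (φ t) (closure (fwdOrbit φ x)) (closure (fwdOrbit φ x)) := by
  refine Set.MapsTo.closure ?_ (hcont t)
  rintro _ ⟨s, hs, rfl⟩
  exact ⟨t + s, add_nonneg ht hs, hadd t s x⟩

/-- Under a transitive flow, a closed forward invariant set with nonempty interior is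
the whole space. -/
theorem TopTransitive.eq_univ_of_isClosed {X : Type*} [TopologicalSpace X] {φ : ℝ → X → X}
    (htt : TopTransitive φ) {A : Set X} (hA : IsClosed A)
    (hinv : ∀ t > 0, Set.MapsTo (φ t) A A) (hint : (interior A).Nonempty) :
    A = Set.univ := by
  by_contra hne
  obtain ⟨t, ht, _, ⟨u, hu, rfl⟩, hv⟩ :=
    htt (interior A) Aᶜ isOpen_interior hA.isOpen_compl hint (Set.nonempty_compl.mpr hne)
  exact hv (hinv t ht (interior_subset hu))

/-- If a continuous, topologically transitive flow on a nonempty complete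
separable metric space `X` satisfies `X = ⋃_{i=1}^n closure (Orb (x i))` for finitely
many points, then some `Orb (x i)` is dense in `X` (a single one of the given
trajectories suffices for discovery). -/
theorem transitive_finite_cover_has_dense_orbit
    {X : Type*} [MetricSpace X] [Nonempty X] [CompleteSpace X]
    [TopologicalSpace.SeparableSpace X]
    (φ : ℝ → X → X) (hcont : Continuous fun p : ℝ × X => φ p.1 p.2)
    (h0 : ∀ x, φ 0 x = x) (hadd : ∀ s t x, φ (s + t) x = φ s (φ t x))
    (htt : TopTransitive φ)
    (n : ℕ) (x : Fin n → X)
    (hcover : (Set.univ : Set X) = ⋃ i, closure (fwdOrbit φ (x i))) :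
    ∃ i, Dense (fwdOrbit φ (x i)) := by
  obtain ⟨i, hi⟩ := nonempty_interior_of_iUnion_of_closed
    (fun i => isClosed_closure (s := fwdOrbit φ (x i))) hcover.symm
  have hφ : ∀ t, Continuous (φ t) := fun t => hcont.comp (Continuous.prodMk_right t)
  exact ⟨i, dense_iff_closure_eq.mpr <| htt.eq_univ_of_isClosed isClosed_closure
    (fun t ht => mapsTo_closure_fwdOrbit hφ hadd (x i) (le_of_lt ht)) hi⟩
end
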